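/- Let Y be a skew-symmetric matrix over a field (or integral domain with appropriate nonvanishing), (a,b,c,d) a sequence of four row/column indices, and K a sequence of row/column indices of odd length. Then Pf Y((a,c,d)⊔K) · Pf Y((b)⊔K) − Pf Y((a,b,d)⊔K) · Pf Y((c)⊔K) + Pf Y((a,b,c)⊔K) · Pf Y((d)⊔K) = Pf Y((b,c,d)⊔K) · Pf Y((a)⊔K). -/

import Mathlib

open Matrix Finset

variable {R : Type*} [Field R]

/-- The index `2i` among `Fin n` (for `n` even, `i < n/2`). -/
def pfLo {n : ℕ} (_h : n % 2 = 0) (i : Fin (n / 2)) : Fin n :=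
  ⟨2 * i.val, by have := i.isLt; omega⟩

/-- The index `2i+1` among `Fin n` (for `n` even, `i < n/2`). -/
def pfHi {n : ℕ} (_h : n % 2 = 0) (i : Fin (n / 2)) : Fin n :=
  ⟨2 * i.val + 1, by have := i.isLt; omega⟩

/-- The Pfaffian of an `n × n` matrix, as the sum
`∑_{π ∈ F_n} sgn(π) · a_{π(1),π(2)} ⋯ a_{π(n−1),π(n)}` over the set `F_n` of permutations
satisfying `π(1) < π(3) < ⋯ < π(n−1)` and `π(2i−1) < π(2i)`; it is `0` when `n` is odd. -/
def pf {n : ℕ} (A : Matrix (Fin n) (Fin n) R) : R :=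
  if h : n % 2 = 0 then
    ∑ π : Equiv.Perm (Fin n),
      if (∀ i : Fin (n / 2), π (pfLo h i) < π (pfHi h i)) ∧
          (∀ i j : Fin (n / 2), i < j → π (pfLo h i) < π (pfLo h j)) then
        ((Equiv.Perm.sign π : ℤ) : R) * ∏ i : Fin (n / 2), A (π (pfLo h i)) (π (pfHi h i))
      else 0
  else 0

/-- `ppf Y I` is the Pfaffian of the principal submatrix `Y(I)` of a skew-symmetric matrix
`Y`, with rows and columns picked (in order) from the index sequence `I`. -/
def ppf {ι : Type*} (Y : Matrix ι ι R) {k : ℕ} (I : Fin k → ι) : R :=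
  pf (Y.submatrix I I)

theorem aux_pf_eq {n k : ℕ} (A : Matrix (Fin n) (Fin n) R) (h : n = 2 * k) :
    pf A = ∑ π : Equiv.Perm (Fin n),
      if (∀ i : Fin k, π ⟨2 * i.val, by omega⟩ < π ⟨2 * i.val + 1, by omega⟩) ∧
          (∀ i j : Fin k, i < j → π ⟨2 * i.val, by omega⟩ < π ⟨2 * j.val, by omega⟩) then
        ((Equiv.Perm.sign π : ℤ) : R) *
          ∏ i : Fin k, A (π ⟨2 * i.val, by omega⟩) (π ⟨2 * i.val + 1, by omega⟩)
      else 0 := by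
  have h0 : n % 2 = 0 := by omega
  obtain rfl : k = n / 2 := by omega
  unfold pf
  rw [dif_pos h0]
  rfl

def auxE {n : ℕ} (j : Fin (n + 1)) (σ : Equiv.Perm (Fin n)) : Equiv.Perm (Fin (n + 1)) :=
  j.cycleRange.symm * Equiv.Perm.decomposeFin.symm (0, σ)

theorem auxE_zero {n : ℕ} (j : Fin (n + 1)) (σ : Equiv.Perm (Fin n)) : auxE j σ 0 = j := by
  simp [auxE]

theorem auxE_succ {n : ℕ} (j : Fin (n + 1)) (σ : Equiv.Perm (Fin n)) (i : Fin n) :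
    auxE j σ i.succ = j.succAbove (σ i) := by
  simp [auxE]

theorem auxE_sign {n : ℕ} (j : Fin (n + 1)) (σ : Equiv.Perm (Fin n)) :
    Equiv.Perm.sign (auxE j σ) = (-1) ^ (j : ℕ) * Equiv.Perm.sign σ := by
  simp [auxE, Equiv.Perm.decomposeFin.symm_sign, Equiv.Perm.sign_symm]

theorem auxE_bij (n : ℕ) :
    Function.Bijective (fun p : Fin (n + 1) × Equiv.Perm (Fin n) => auxE p.1 p.2) := by
  rw [Fintype.bijective_iff_injective_and_card]
  constructor
  · rintro ⟨j, σ⟩ ⟨j', σ'⟩ h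
    have h : auxE j σ = auxE j' σ' := h
    have h0 : j = j' := by
      have := DFunLike.congr_fun h 0
      simpa [auxE_zero] using this
    subst h0
    congr 1
    ext i : 1
    have := DFunLike.congr_fun h i.succ
    simpa [auxE_succ] using this
  · simp [Fintype.card_perm, Nat.factorial_succ]

theorem auxE_sum {n : ℕ} (f : Equiv.Perm (Fin (n + 1)) → R) :
    ∑ π, f π = ∑ j, ∑ σ, f (auxE j σ) := by
  rw [← (auxE_bij n).sum_comp f, Fintype.sum_prod_type]

theorem aux_pf_succ {m : ℕ} (A : Matrix (Fin (m + 2)) (Fin (m + 2)) R) :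
    pf A = ∑ j : Fin (m + 1), (-1) ^ (j : ℕ) * A 0 j.succ *
      pf (A.submatrix (fun i => (j.succAbove i).succ) (fun i => (j.succAbove i).succ)) := by
  by_cases hm : m % 2 = 0
  swap
  · have h1 : ¬ (m + 2) % 2 = 0 := by omega
    simp [pf, hm]
  obtain ⟨k, hk⟩ : ∃ k, m = 2 * k := ⟨m / 2, by omega⟩
  rw [aux_pf_eq (k := k + 1) A (by omega), auxE_sum, Fin.sum_univ_succ]
  rw [Finset.sum_eq_zero (s := univ) (f := fun i : Fin (m + 1) => _), add_zero, auxE_sum]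
  · refine Finset.sum_congr rfl fun j _ => ?_
    rw [aux_pf_eq (k := k) _ hk, Finset.mul_sum]
    refine Finset.sum_congr rfl fun σ _ => ?_
    have e0 : auxE 0 (auxE j σ) 0 = 0 := auxE_zero _ _
    have e1 : auxE 0 (auxE j σ) 1 = j.succ := by
      have := auxE_succ 0 (auxE j σ) 0
      rw [auxE_zero] at this
      simpa using this
    have e2 : ∀ i : Fin m, auxE 0 (auxE j σ) i.succ.succ = (j.succAbove (σ i)).succ := by
      intro i
      rw [auxE_succ, auxE_succ]; simp
    have f0 : ∀ i : Fin k, (⟨2 * (i.succ : Fin (k + 1)).val, by omega⟩ : Fin (m + 2)) =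
        (⟨2 * i.val, by omega⟩ : Fin m).succ.succ := by
      intro i; ext; simp; ring
    have f1 : ∀ i : Fin k, (⟨2 * (i.succ : Fin (k + 1)).val + 1, by omega⟩ : Fin (m + 2)) =
        (⟨2 * i.val + 1, by omega⟩ : Fin m).succ.succ := by
      intro i; ext; simp; ring
    have z0 : (⟨2 * (0 : Fin (k + 1)).val, by omega⟩ : Fin (m + 2)) = 0 := by ext; simp
    have z1 : (⟨2 * (0 : Fin (k + 1)).val + 1, by omega⟩ : Fin (m + 2)) = 1 := by ext; simp
    have lt : ∀ x y : Fin m, (j.succAbove x).succ < (j.succAbove y).succ ↔ x < y := by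
      intro x y
      rw [Fin.succ_lt_succ_iff, (Fin.strictMono_succAbove j).lt_iff_lt]
    rw [Fin.prod_univ_succ, auxE_sign, auxE_sign]
    simp only [Fin.forall_fin_succ, f0, f1, z0, z1, e0, e1, e2, lt, Matrix.submatrix_apply,
      Fin.succ_lt_succ_iff, Fin.succ_pos, lt_irrefl, Fin.not_lt_zero, true_and, and_true,
      false_imp_iff, imp_true_iff, forall_const, forall_true_left]
    split_ifs
    · push_cast
      simp
      ring
    · simp
  · intro i _
    refine Finset.sum_eq_zero fun σ _ => ?_
    rw [if_neg]
    rintro ⟨h1, h2⟩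
    set π := auxE i.succ σ with hπ
    have h0 : π 0 = i.succ := auxE_zero _ _
    have key : ∀ x, π 0 ≤ π x := by
      intro x
      have hlo : ∀ q : Fin (k + 1), π 0 ≤ π ⟨2 * q.val, by omega⟩ := by
        intro q
        rcases Fin.eq_zero_or_eq_succ q with rfl | ⟨q', rfl⟩
        · exact le_of_eq (congrArg π (by ext; simp))
        · have := (h2 0 q'.succ (Fin.succ_pos _)).le
          refine le_trans (le_of_eq (congrArg π (by ext; simp))) this
      have hx := x.isLt
      rcases Nat.even_or_odd' x.val with ⟨c, hc | hc⟩
      · have := hlo ⟨c, by omega⟩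
        exact this.trans (le_of_eq (congrArg π (by ext; simp [hc])))
      · have h3 := hlo ⟨c, by omega⟩
        have h4 := (h1 ⟨c, by omega⟩).le
        exact (h3.trans h4).trans (le_of_eq (congrArg π (by ext; simp [hc])))
    have := key (π.symm 0)
    rw [Equiv.apply_symm_apply, h0] at this
    exact absurd this (by simp [Fin.le_def])

section ExtPart

variable {V : Type*} [AddCommGroup V] [Module R V]

theorem aux_exists_P (B : LinearMap.BilinForm R V) (hB : ∀ v, B v v = 0) :
    ∃ P : ExteriorAlgebra R V →ₗ[R] R, P 1 = 1 ∧
      ∀ v x, P (ExteriorAlgebra.ι R v * x) = P (CliffordAlgebra.contractLeft (B v) x) := by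
  have h : (-B).toQuadraticMap = (0 : QuadraticForm R V) - 0 := by
    ext v; simp [hB]
  refine ⟨(ExteriorAlgebra.algebraMapInv (R := R) (M := V)).toLinearMap ∘ₗ
    CliffordAlgebra.changeForm h, ?_, ?_⟩
  · simp
  · intro v x
    simp only [LinearMap.comp_apply, AlgHom.toLinearMap_apply]
    rw [CliffordAlgebra.changeForm_contractLeft, CliffordAlgebra.changeForm_ι_mul]
    have : ExteriorAlgebra.algebraMapInv (R := R) (ExteriorAlgebra.ι R v) = 0 := by
      simp [ExteriorAlgebra.algebraMapInv]
    rw [map_sub, map_mul, this]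
    simp

def auxW {m : ℕ} (v : Fin m → V) : ExteriorAlgebra R V :=
  (List.ofFn (fun i => ExteriorAlgebra.ι R (v i))).prod

theorem auxW_succ {m : ℕ} (v : Fin (m + 1) → V) :
    (auxW v : ExteriorAlgebra R V) = ExteriorAlgebra.ι R (v 0) * auxW (fun i => v i.succ) := by
  simp [auxW, List.ofFn_succ]

theorem aux_contract {m : ℕ} (d : Module.Dual R V) (v : Fin (m + 1) → V) :
    CliffordAlgebra.contractLeft d (auxW v : ExteriorAlgebra R V) =
      ∑ j : Fin (m + 1), ((-1) ^ (j : ℕ) * d (v j)) •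
        (auxW (fun i => v (j.succAbove i)) : ExteriorAlgebra R V) := by
  induction m with
  | zero =>
    rw [auxW_succ, CliffordAlgebra.contractLeft_ι_mul]
    simp [auxW]
  | succ m ih =>
    rw [auxW_succ, CliffordAlgebra.contractLeft_ι_mul, ih, Fin.sum_univ_succ (n := m + 1)]
    simp only [Fin.succAbove_zero, Fin.val_zero, pow_zero, one_mul, sub_eq_add_neg]
    congr 1
    rw [Finset.mul_sum, ← Finset.sum_neg_distrib]
    refine Finset.sum_congr rfl fun j _ => ?_
    rw [auxW_succ (fun i => v (j.succ.succAbove i))]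
    simp [pow_succ]

theorem aux_pf_P (B : LinearMap.BilinForm R V) (P : ExteriorAlgebra R V →ₗ[R] R) (hP1 : P 1 = 1)
    (hP : ∀ v x, P (ExteriorAlgebra.ι R v * x) = P (CliffordAlgebra.contractLeft (B v) x))
    (m : ℕ) (A : Matrix (Fin m) (Fin m) R) (v : Fin m → V)
    (hA : ∀ i j, i < j → A i j = B (v i) (v j)) : pf A = P (auxW v) := by
  induction m using Nat.twoStepInduction with
  | zero => simp [pf, auxW, hP1]
  | one =>
    rw [auxW_succ, hP]
    simp [pf, auxW]
  | more m ih _ =>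
    rw [aux_pf_succ, auxW_succ, hP, aux_contract, map_sum]
    refine Finset.sum_congr rfl fun j _ => ?_
    rw [map_smul, hA 0 j.succ (Fin.succ_pos _), smul_eq_mul]
    congr 1
    apply ih
    intro i i' hi
    apply hA
    rw [Fin.succ_lt_succ_iff]
    exact Fin.strictMono_succAbove j hi

theorem aux_ι_mul {m : ℕ} (v : Fin m → V) (j : Fin m) :
    ExteriorAlgebra.ι R (v j) * auxW v = 0 := by
  induction m with
  | zero => exact j.elim0
  | succ m ih =>
    rw [auxW_succ, ← mul_assoc]
    rcases Fin.eq_zero_or_eq_succ j with rfl | ⟨j, rfl⟩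
    · simp
    · have := ExteriorAlgebra.ι_add_mul_swap (R := R) (v j.succ) (v 0)
      rw [eq_neg_of_add_eq_zero_left this, neg_mul, mul_assoc, ih (fun i => v i.succ) j]
      simp

theorem aux_span {m : ℕ} (v : Fin m → V) (u : V) (hu : u ∈ Submodule.span R (Set.range v)) :
    ExteriorAlgebra.ι R u * auxW v = 0 := by
  induction hu using Submodule.span_induction with
  | mem x h => obtain ⟨j, rfl⟩ := h; exact aux_ι_mul v j
  | zero => simp
  | add x y _ _ hx hy => rw [map_add, add_mul, hx, hy, add_zero]
  | smul r x _ hx => rw [map_smul, smul_mul_assoc, hx, smul_zero]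

theorem aux_u {m : ℕ} (v : Fin m → V) (F : ExteriorAlgebra R V →ₗ[R] R) :
    ∃ u ∈ Submodule.span R (Set.range v), ∀ d : Module.Dual R V,
      F (CliffordAlgebra.contractLeft d (auxW v : ExteriorAlgebra R V)) = d u := by
  cases m with
  | zero => exact ⟨0, zero_mem _, fun d => by simp [auxW]⟩
  | succ m =>
    refine ⟨∑ j : Fin (m + 1), ((-1) ^ (j : ℕ) * F (auxW (fun i => v (j.succAbove i)))) • v j,
      Submodule.sum_mem _ fun j _ => Submodule.smul_mem _ _ (Submodule.subset_span ⟨j, rfl⟩), ?_⟩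
    intro d
    rw [aux_contract, map_sum, map_sum]
    refine Finset.sum_congr rfl fun j _ => ?_
    simp; ring

theorem aux_contract_zero {m : ℕ} (v : Fin m → V) (d : Module.Dual R V) (h : ∀ j, d (v j) = 0) :
    CliffordAlgebra.contractLeft d (auxW v : ExteriorAlgebra R V) = 0 := by
  cases m with
  | zero => simp [auxW]
  | succ m => rw [aux_contract]; simp [h]

open ExteriorAlgebra in
theorem aux_main (B : LinearMap.BilinForm R V) (hB : ∀ x y, B x y = - B y x)
    (P : ExteriorAlgebra R V →ₗ[R] R)
    (hP : ∀ v x, P (ExteriorAlgebra.ι R v * x) = P (CliffordAlgebra.contractLeft (B v) x))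
    (a b c d : V) {n : ℕ} (v : Fin n → V) :
    P (ι R a * (ι R c * (ι R d * auxW v))) * P (ι R b * auxW v)
     - P (ι R a * (ι R b * (ι R d * auxW v))) * P (ι R c * auxW v)
     + P (ι R a * (ι R b * (ι R c * auxW v))) * P (ι R d * auxW v)
     = P (ι R b * (ι R c * (ι R d * auxW v))) * P (ι R a * auxW v) := by
  obtain ⟨u, hu, hu'⟩ := aux_u v P
  have hd : ∀ x, P (ι R x * auxW v) = - B u x := by
    intro x
    rw [hP, hu', hB]
  have hz : CliffordAlgebra.contractLeft (B u) (auxW v : ExteriorAlgebra R V) = 0 := by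
    apply aux_contract_zero
    intro j
    have := hd (v j)
    rw [aux_ι_mul, map_zero] at this
    simpa using this.symm
  have sw : ∀ x z, (ι R u * (ι R x * z) : ExteriorAlgebra R V) = - (ι R x * (ι R u * z)) := by
    intro x z
    rw [← mul_assoc, eq_neg_of_add_eq_zero_left (ι_add_mul_swap (R := R) u x), neg_mul, mul_assoc]
  have key := hP u (ι R a * (ι R b * (ι R c * (ι R d * auxW v))))
  rw [sw, sw, sw, sw, aux_span v u hu] at key
  rw [CliffordAlgebra.contractLeft_ι_mul, CliffordAlgebra.contractLeft_ι_mul,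
    CliffordAlgebra.contractLeft_ι_mul, CliffordAlgebra.contractLeft_ι_mul, hz] at key
  simp only [mul_zero, neg_zero, map_zero, sub_zero, mul_sub, map_sub, mul_smul_comm, map_smul,
    smul_eq_mul] at key
  rw [hd, hd, hd, hd]
  linear_combination -key

end ExtPart

theorem aux_ppf_eq {ι' : Type*} (Y : Matrix ι' ι' R) {N m : ℕ} (w : Fin N → ι')
    (B : LinearMap.BilinForm R (Fin N → R))
    (hB : ∀ p q, p < q → B (Pi.single p 1) (Pi.single q 1) = Y (w p) (w q))
    (P : ExteriorAlgebra R (Fin N → R) →ₗ[R] R) (hP1 : P 1 = 1)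
    (hP : ∀ v x, P (ExteriorAlgebra.ι R v * x) = P (CliffordAlgebra.contractLeft (B v) x))
    (s : Fin m → Fin N) (hs : StrictMono s) (I : Fin m → ι') (hI : ∀ i, I i = w (s i)) :
    ppf Y I = P (auxW (fun i => Pi.single (s i) 1)) := by
  apply aux_pf_P B P hP1 hP
  intro i j hij
  rw [hB _ _ (hs hij), Matrix.submatrix_apply, hI, hI]

theorem aux_append {k n : ℕ} (p : Fin k → Fin (4 + n)) (hp : StrictMono p)
    (hp4 : ∀ i, (p i).val < 4) : StrictMono (Fin.append p (Fin.natAdd 4)) := by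
  intro i j hij
  induction i using Fin.addCases with
  | left i =>
    induction j using Fin.addCases with
    | left j =>
      simp only [Fin.append_left]
      rw [Fin.lt_def, Fin.val_castAdd, Fin.val_castAdd] at hij
      exact hp hij
    | right j =>
      simp only [Fin.append_left, Fin.append_right, Fin.lt_def, Fin.val_natAdd]
      have := hp4 i
      omega
  | right i =>
    induction j using Fin.addCases with
    | left j =>
      rw [Fin.lt_def, Fin.val_natAdd, Fin.val_castAdd] at hij
      omega
    | right j =>
      rw [Fin.append_right, Fin.append_right, Fin.lt_def, Fin.val_natAdd, Fin.val_natAdd]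
      rw [Fin.lt_def, Fin.val_natAdd, Fin.val_natAdd] at hij
      omega

theorem auxW_append {V : Type*} [AddCommGroup V] [Module R V] {k n N : ℕ} (f : Fin N → V)
    (p : Fin k → Fin N) (q : Fin n → Fin N) :
    (auxW (fun i => f (Fin.append p q i)) : ExteriorAlgebra R V) =
      (List.ofFn (fun i => ExteriorAlgebra.ι R (f (p i)))).prod * auxW (fun i => f (q i)) := by
  unfold auxW
  have : (fun i => ExteriorAlgebra.ι R (f (Fin.append p q i))) =
      Fin.append (fun i => ExteriorAlgebra.ι R (f (p i)))
        (fun i => ExteriorAlgebra.ι R (f (q i))) := by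
    ext i
    induction i using Fin.addCases <;> simp
  rw [this, List.ofFn_fin_append, List.prod_append]

/-- For a skew-symmetric matrix `Y` over a field, indices `a, b, c, d` and a sequence `K`
of odd length:
`Pf Y((a,c,d)⊔K) · Pf Y((b)⊔K) − Pf Y((a,b,d)⊔K) · Pf Y((c)⊔K)
 + Pf Y((a,b,c)⊔K) · Pf Y((d)⊔K) = Pf Y((b,c,d)⊔K) · Pf Y((a)⊔K)`. -/
theorem pf_special13 {ι : Type*} (Y : Matrix ι ι R) (hY : Yᵀ = -Y)
    (a b c d : ι) {n : ℕ} (hn : n % 2 = 1) (K : Fin n → ι) :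
    ppf Y (Fin.append ![a, c, d] K) * ppf Y (Fin.append ![b] K)
      - ppf Y (Fin.append ![a, b, d] K) * ppf Y (Fin.append ![c] K)
      + ppf Y (Fin.append ![a, b, c] K) * ppf Y (Fin.append ![d] K)
      = ppf Y (Fin.append ![b, c, d] K) * ppf Y (Fin.append ![a] K) := by
  classical
  set w : Fin (4 + n) → ι := Fin.append ![a, b, c, d] K with hw
  let U : Matrix (Fin (4 + n)) (Fin (4 + n)) R := fun p q => if p < q then Y (w p) (w q) else 0
  let B0 : LinearMap.BilinForm R (Fin (4 + n) → R) := Matrix.toBilin' U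
  let B : LinearMap.BilinForm R (Fin (4 + n) → R) := B0 - B0.flip
  have hBa : ∀ x y, B x y = - B y x := by
    intro x y; simp [B]
  have hB0 : ∀ v, B v v = 0 := by
    intro x; simp [B]
  have hB : ∀ p q, p < q → B (Pi.single p 1) (Pi.single q 1) = Y (w p) (w q) := by
    intro p q hpq
    have h1 : ∀ p q, B0 (Pi.single p 1) (Pi.single q 1) = U p q :=
      fun p q => Matrix.toBilin'_single U p q
    have h2 : B (Pi.single p 1) (Pi.single q 1) = U p q - U q p := by
      rw [← h1, ← h1]; rfl
    rw [h2]
    simp [U, hpq, hpq.le]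
  obtain ⟨P, hP1, hP⟩ := aux_exists_P B hB0
  have main := aux_main B hBa P hP (Pi.single (Fin.castAdd n 0) 1) (Pi.single (Fin.castAdd n 1) 1)
    (Pi.single (Fin.castAdd n 2) 1) (Pi.single (Fin.castAdd n 3) 1)
    (fun i : Fin n => Pi.single (Fin.natAdd 4 i) (1 : R))
  have conv : ∀ (k : ℕ) (p : Fin k → Fin 4) (hp : StrictMono p) (x : Fin k → ι)
      (hx : ∀ i, x i = ![a, b, c, d] (p i)),
      ppf Y (Fin.append x K) =
        P ((List.ofFn (fun i => ExteriorAlgebra.ι R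
          (Pi.single (Fin.castAdd n (p i)) (1 : R) : Fin (4 + n) → R))).prod *
          auxW (fun i : Fin n => (Pi.single (Fin.natAdd 4 i) (1 : R) : Fin (4 + n) → R))) := by
    intro k p hp x hx
    rw [aux_ppf_eq Y w B hB P hP1 hP (Fin.append (fun i => Fin.castAdd n (p i)) (Fin.natAdd 4))
      (aux_append _ (fun i j h => hp h) (fun i => (p i).isLt)) (Fin.append x K),
      auxW_append (fun r => Pi.single r 1)]
    intro i
    induction i using Fin.addCases with
    | left i => simp only [hw, Fin.append_left, hx]
    | right i => simp only [hw, Fin.append_right]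
  rw [conv 3 ![0, 2, 3] (by decide) ![a, c, d] (by intro i; fin_cases i <;> rfl),
    conv 3 ![0, 1, 3] (by decide) ![a, b, d] (by intro i; fin_cases i <;> rfl),
    conv 3 ![0, 1, 2] (by decide) ![a, b, c] (by intro i; fin_cases i <;> rfl),
    conv 3 ![1, 2, 3] (by decide) ![b, c, d] (by intro i; fin_cases i <;> rfl),
    conv 1 ![0] (by decide) ![a] (by intro i; fin_cases i; rfl),
    conv 1 ![1] (by decide) ![b] (by intro i; fin_cases i; rfl),
    conv 1 ![2] (by decide) ![c] (by intro i; fin_cases i; rfl),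
    conv 1 ![3] (by decide) ![d] (by intro i; fin_cases i; rfl)]
  simpa [List.ofFn_succ, mul_assoc] using main
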